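/- arXiv:math/0412318 — 2 statements merged into one kernel-verified Lean document; each statement's English description precedes it below -/
import Mathlib

section
/- Let W be a finite-dimensional real vector space, g((X, α), (Y, β)) = (1/2)(β(X) + α(Y)) the canonical symmetric form on W × W*, L ⊆ W × W* a maximal isotropic subspace, and L₊ := pr_W(L) the projection of L to W. Then: (i) if (0, γ) ∈ L then γ(Y) = 0 for all Y ∈ L₊; (ii) for (X, α) ∈ L and Y ∈ L₊ the value α(Y) depends only on X and Y, and the resulting form ω₊ on L₊, defined by ω₊(X, Y) = α(Y) for any α with (X, α) ∈ L, is a well-defined skew-symmetric bilinear form on L₊. -/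
/-- The canonical symmetric pairing `g((X,α),(Y,β)) = (1/2)(β(X) + α(Y))` on `W × W*`. -/
noncomputable def cpair {W : Type*} [AddCommGroup W] [Module ℝ W]
    (p q : W × Module.Dual ℝ W) : ℝ :=
  (1/2 : ℝ) * (q.2 p.1 + p.2 q.1)

/-- A subspace of `W × W*` is isotropic if the canonical pairing vanishes on it. -/
def IsIsotropic {W : Type*} [AddCommGroup W] [Module ℝ W]
    (L : Submodule ℝ (W × Module.Dual ℝ W)) : Prop :=
  ∀ p ∈ L, ∀ q ∈ L, cpair p q = 0

/-- `L₊ = pr_W(L)`, the projection of `L ⊆ W × W*` to `W`. -/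
def Lplus {W : Type*} [AddCommGroup W] [Module ℝ W]
    (L : Submodule ℝ (W × Module.Dual ℝ W)) : Submodule ℝ W :=
  Submodule.map (LinearMap.fst ℝ W (Module.Dual ℝ W)) L

theorem IsIsotropic.apply_eq_neg {W : Type*} [AddCommGroup W] [Module ℝ W]
    {L : Submodule ℝ (W × Module.Dual ℝ W)} (hL : IsIsotropic L)
    {X Y : W} {α β : Module.Dual ℝ W} (hX : (X, α) ∈ L) (hY : (Y, β) ∈ L) :
    α Y = -β X := by
  have h := hL _ hX _ hY
  simp only [cpair] at h
  linarith

theorem IsIsotropic.apply_eq_apply {W : Type*} [AddCommGroup W] [Module ℝ W]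
    {L : Submodule ℝ (W × Module.Dual ℝ W)} (hL : IsIsotropic L)
    {X Y : W} {α α' : Module.Dual ℝ W} (hα : (X, α) ∈ L) (hα' : (X, α') ∈ L)
    (hY : Y ∈ Lplus L) : α Y = α' Y := by
  obtain ⟨⟨_, β⟩, hβ, rfl⟩ := hY
  exact (hL.apply_eq_neg hα hβ).trans (hL.apply_eq_neg hα' hβ).symm

/-- For a maximal isotropic `L ⊆ W × W*` with `L₊ = pr_W(L)`:
(i) if `(0, γ) ∈ L` then `γ` vanishes on `L₊`; (ii) for `(X, α) ∈ L` and `Y ∈ L₊` the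
value `α(Y)` depends only on `X` and `Y`, and `ω₊(X, Y) := α(Y)` is a well-defined
skew-symmetric bilinear form on `L₊`. -/
theorem stmt8 {W : Type*} [AddCommGroup W] [Module ℝ W] [FiniteDimensional ℝ W]
    (L : Submodule ℝ (W × Module.Dual ℝ W))
    (hiso : IsIsotropic L)
    (hmax : ∀ L' : Submodule ℝ (W × Module.Dual ℝ W), IsIsotropic L' → L ≤ L' → L' = L) :
    (∀ γ : Module.Dual ℝ W, ((0 : W), γ) ∈ L → ∀ Y ∈ Lplus L, γ Y = 0) ∧
    (∀ (X : W) (α α' : Module.Dual ℝ W), (X, α) ∈ L → (X, α') ∈ L →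
      ∀ Y ∈ Lplus L, α Y = α' Y) ∧
    (∃ ωp : ↥(Lplus L) →ₗ[ℝ] ↥(Lplus L) →ₗ[ℝ] ℝ,
      (∀ u v, ωp u v = - ωp v u) ∧
      ∀ (X : W) (α : Module.Dual ℝ W) (h : (X, α) ∈ L) (Y : W) (hY : Y ∈ Lplus L),
        ωp ⟨X, ⟨(X, α), h, rfl⟩⟩ ⟨Y, hY⟩ = α Y) := by
  refine ⟨fun γ hγ Y hY => hiso.apply_eq_apply hγ L.zero_mem hY,
    fun X α α' hα hα' Y hY => hiso.apply_eq_apply hα hα' hY, ?_⟩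
  have hlift : ∀ u : Lplus L, ∃ α : Module.Dual ℝ W, ((u : W), α) ∈ L := by
    rintro ⟨_, ⟨X, α⟩, h, rfl⟩
    exact ⟨α, h⟩
  choose a ha using hlift
  refine ⟨LinearMap.mk₂ ℝ (fun u v => a u v) ?_ ?_ ?_ ?_, ?_, ?_⟩
  · intro u u' v
    exact hiso.apply_eq_apply (ha (u + u')) (L.add_mem (ha u) (ha u')) v.2
  · intro c u v
    exact hiso.apply_eq_apply (ha (c • u)) (L.smul_mem c (ha u)) v.2
  · intro u v v'
    exact map_add (a u) _ _
  · intro c u v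
    exact map_smul (a u) c _
  · intro u v
    exact hiso.apply_eq_neg (ha u) (ha v)
  · intro X α h Y hY
    exact hiso.apply_eq_apply (ha ⟨X, ⟨(X, α), h, rfl⟩⟩) h hY
end

section
/- Let W be a finite-dimensional real vector space, L ⊆ W × W* a maximal isotropic subspace for the canonical symmetric form g((X, α), (Y, β)) = (1/2)(β(X) + α(Y)), L₊ := pr_W(L), and let ω₊ be the skew-symmetric bilinear form on L₊ determined by ω₊(X, Y) = α(Y) whenever (X, α) ∈ L and Y ∈ L₊. Then L = { (X, α) ∈ W × W* : X ∈ L₊ and α(Y) = ω₊(X, Y) for all Y ∈ L₊ }. -/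
/-- A null vector orthogonal to a maximal isotropic subspace lies in that subspace. -/
theorem mem_of_cpair_eq_zero {W : Type*} [AddCommGroup W] [Module ℝ W]
    {L : Submodule ℝ (W × Module.Dual ℝ W)} (hiso : IsIsotropic L)
    (hmax : ∀ L' : Submodule ℝ (W × Module.Dual ℝ W), IsIsotropic L' → L ≤ L' → L' = L)
    {p : W × Module.Dual ℝ W} (hp : cpair p p = 0) (hpL : ∀ q ∈ L, cpair p q = 0) :
    p ∈ L := by
  have hsup : IsIsotropic (L ⊔ Submodule.span ℝ {p}) := by
    intro x hx y hy
    obtain ⟨u, hu, _, ha, rfl⟩ := Submodule.mem_sup.1 hx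
    obtain ⟨v, hv, _, hb, rfl⟩ := Submodule.mem_sup.1 hy
    obtain ⟨a, rfl⟩ := Submodule.mem_span_singleton.1 ha
    obtain ⟨b, rfl⟩ := Submodule.mem_span_singleton.1 hb
    have huv := hiso u hu v hv
    have hpu := hpL u hu
    have hpv := hpL v hv
    simp only [cpair, Prod.fst_add, Prod.snd_add, Prod.smul_fst, Prod.smul_snd, map_add,
      map_smul, LinearMap.add_apply, LinearMap.smul_apply, smul_eq_mul] at *
    linear_combination huv + b * hpu + a * hpv + a * b * hp
  rw [← hmax _ hsup le_sup_left]
  exact Submodule.mem_sup_right (Submodule.mem_span_singleton_self p)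

/-- For a maximal isotropic `L ⊆ W × W*` and the form `ω₊` on
`L₊ = pr_W(L)` determined by `ω₊(X, Y) = α(Y)` whenever `(X, α) ∈ L` and `Y ∈ L₊`, the
subspace `L` is reconstructed as
`L = {(X, α) : X ∈ L₊ and α(Y) = ω₊(X, Y) for all Y ∈ L₊}`. -/
theorem stmt9 {W : Type*} [AddCommGroup W] [Module ℝ W] [FiniteDimensional ℝ W]
    (L : Submodule ℝ (W × Module.Dual ℝ W))
    (hiso : IsIsotropic L)
    (hmax : ∀ L' : Submodule ℝ (W × Module.Dual ℝ W), IsIsotropic L' → L ≤ L' → L' = L)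
    (ωp : W → W → ℝ)
    (hωp : ∀ (X : W) (α : Module.Dual ℝ W), (X, α) ∈ L → ∀ Y ∈ Lplus L, ωp X Y = α Y) :
    ∀ (X : W) (α : Module.Dual ℝ W),
      (X, α) ∈ L ↔ (X ∈ Lplus L ∧ ∀ Y ∈ Lplus L, α Y = ωp X Y) := by
  intro X α
  constructor
  · intro h
    exact ⟨⟨(X, α), h, rfl⟩, fun Y hY => (hωp X α h Y hY).symm⟩
  · rintro ⟨⟨⟨X', β⟩, hβ, hX⟩, hα⟩
    obtain rfl : X' = X := hX
    have hγ : ∀ q ∈ L, (α - β) q.1 = 0 := by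
      intro q hq
      have hq' : q.1 ∈ Lplus L := ⟨q, hq, rfl⟩
      simp [hα _ hq', hωp _ _ hβ _ hq']
    have hmem : ((0, α - β) : W × Module.Dual ℝ W) ∈ L :=
      mem_of_cpair_eq_zero hiso hmax (by simp [cpair])
        fun q hq => by simpa [cpair] using hγ q hq
    simpa using L.add_mem hβ hmem
end
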